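/- Let A be a type and s : Multiset A → List A a section of the canonical quotient map satisfying head-least and tail-sort, with derived relation ≤ₛ. Then for every m : Multiset A, consecutive elements of the list s m are related by ≤ₛ (i.e. List.Chain' (· ≤ₛ ·) (s m)); equivalently, a list xs : List A is in the image of s if and only if List.Chain' (· ≤ₛ ·) xs holds. -/

import Mathlib

/-- `s` is a section of the canonical quotient map `List A → Multiset A`. -/
def IsSection {A : Type*} (s : Multiset A → List A) : Prop :=
  ∀ m : Multiset A, (↑(s m) : Multiset A) = m

/-- A list is in the image of `s`. -/
def InImage {A : Type*} (s : Multiset A → List A) (xs : List A) : Prop :=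
  ∃ m : Multiset A, s m = xs

/-- The head-least axiom for a section. -/
def HeadLeast {A : Type*} (s : Multiset A → List A) : Prop :=
  ∀ (x y : A) (xs : List A), y ∈ x :: xs → InImage s (x :: xs) → InImage s [x, y]

/-- The tail-sort axiom for a section. -/
def TailSort {A : Type*} (s : Multiset A → List A) : Prop :=
  ∀ (x : A) (xs : List A), InImage s (x :: xs) → InImage s xs

/-- A sorting function: a section satisfying head-least and tail-sort. -/
def SortingFunction (A : Type*) : Type _ :=
  {s : Multiset A → List A // IsSection s ∧ HeadLeast s ∧ TailSort s}

/-- The derived relation `≤ₛ` of a section `s`. -/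
def DerivedRel {A : Type*} (s : Multiset A → List A) (x y : A) : Prop :=
  (s {x, y}).head? = some x

theorem IsSection.inImage_iff {A : Type*} {s : Multiset A → List A} (hs : IsSection s)
    (xs : List A) : InImage s xs ↔ s (xs : Multiset A) = xs := by
  constructor
  · rintro ⟨m, rfl⟩
    rw [hs m]
  · exact fun h => ⟨_, h⟩

theorem IsSection.derivedRel_iff {A : Type*} {s : Multiset A → List A} (hs : IsSection s)
    (x y : A) : DerivedRel s x y ↔ InImage s [x, y] := by
  rw [hs.inImage_iff]
  change (s {x, y}).head? = some x ↔ s {x, y} = [x, y]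
  constructor
  · intro h
    obtain ⟨t, ht⟩ := List.head?_eq_some_iff.mp h
    have hp : (s {x, y}).Perm [x, y] := Multiset.coe_eq_coe.mp (hs {x, y})
    rw [ht] at hp ⊢
    rw [List.perm_singleton.mp ((List.perm_cons x).mp hp)]
  · intro h
    rw [h, List.head?_cons]

theorem DerivedRel.antisymm {A : Type*} {s : Multiset A → List A}
    {x y : A} (hxy : DerivedRel s x y) (hyx : DerivedRel s y x) : x = y := by
  have h : some x = some y := by
    rw [← hxy, ← hyx, Multiset.pair_comm]
  exact Option.some.inj h

theorem IsSection.derivedRel_trans {A : Type*} {s : Multiset A → List A} (hs : IsSection s)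
    (hhl : HeadLeast s) {x y z : A} (hxy : DerivedRel s x y) (hyz : DerivedRel s y z) :
    DerivedRel s x z := by
  have hp : (s ([x, y, z] : List A)).Perm [x, y, z] := Multiset.coe_eq_coe.mp (hs _)
  obtain ⟨a, t, hat⟩ : ∃ a t, s ([x, y, z] : List A) = a :: t :=
    List.exists_cons_of_ne_nil fun h => by simp [h] at hp
  rw [hat] at hp
  have least : ∀ b ∈ [x, y, z], DerivedRel s a b := fun b hb =>
    (hs.derivedRel_iff a b).mpr (hhl a b t (hp.mem_iff.mpr hb) ⟨_, hat⟩)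
  have ha : a ∈ [x, y, z] := hp.mem_iff.mp List.mem_cons_self
  simp only [List.mem_cons, List.not_mem_nil, or_false] at ha
  rcases ha with rfl | rfl | rfl
  · exact least z (by simp)
  · rwa [hxy.antisymm (least x (by simp))]
  · rwa [← hyz.antisymm (least y (by simp))]

theorem IsSection.pairwise_derivedRel {A : Type*} {s : Multiset A → List A} (hs : IsSection s)
    (hhl : HeadLeast s) (hts : TailSort s) {xs : List A} (h : InImage s xs) :
    xs.Pairwise (DerivedRel s) := by
  induction xs with
  | nil => exact List.Pairwise.nil
  | cons x xs ih =>
    exact List.Pairwise.cons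
      (fun y hy => (hs.derivedRel_iff x y).mpr (hhl x y xs (List.mem_cons_of_mem x hy) h))
      (ih (hts x xs h))

theorem sortingFunction_chain'_derivedRel {A : Type*} (s : Multiset A → List A)
    (hs : IsSection s) (hhl : HeadLeast s) (hts : TailSort s) :
    (∀ m : Multiset A, List.Chain' (DerivedRel s) (s m)) ∧
    (∀ xs : List A, InImage s xs ↔ List.Chain' (DerivedRel s) xs) := by
  refine ⟨fun m => (hs.pairwise_derivedRel hhl hts ⟨m, rfl⟩).isChain, fun xs =>
    ⟨fun h => (hs.pairwise_derivedRel hhl hts h).isChain, fun h => ?_⟩⟩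
  have : IsTrans A (DerivedRel s) := ⟨fun _ _ _ => hs.derivedRel_trans hhl⟩
  have hxs : xs.Pairwise (DerivedRel s) := List.isChain_iff_pairwise.mp h
  exact ⟨xs, (Multiset.coe_eq_coe.mp (hs xs)).eq_of_pairwise
    (fun _ _ _ _ => DerivedRel.antisymm) (hs.pairwise_derivedRel hhl hts ⟨_, rfl⟩) hxs⟩
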